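/- Let K ≥ 1, let f : (Fin K → ℤ) → ℝ be any function, let j be an index, let λ > 0 and μ > 0 be reals, and set ρ = λ/μ. Let e_j denote the j-th unit vector. Define h : (Fin K → ℤ) → ℝ by h(q̄) = (1/ρ) · Σ_{i=1}^{q_j} Σ_{m=0}^{q_j−i} f(q̄ − (i+m)·e_j) · ((q_j−i)!/(q_j−i−m)!) · ρ^{−m}, where q_j is the j-th coordinate of q̄ and the sums are empty (so h(q̄) = 0) when q_j ≤ 0. Then for every q̄ with q_j ≥ 0: λ·(h(q̄ + e_j) − h(q̄)) − μ·q_j·(h(q̄) − h(q̄ − e_j)) = μ·f(q̄); equivalently, ρ·(h(q̄ + e_j) − h(q̄)) − q_j·(h(q̄) − h(q̄ − e_j)) = f(q̄). -/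

import Mathlib

open Finset in
/-- The increment `ρ (h (q + e_j) - h q)` of the kernel at `q_j = r`, where `F k` is the value of `f`
at the state whose `j`-th coordinate is `k`. -/
noncomputable def kernelIncrement (F : ℕ → ℝ) (ρ : ℝ) (r : ℕ) : ℝ :=
  ∑ m ∈ range (r + 1),
    F (r - m) * ((Nat.factorial r : ℝ) / (Nat.factorial (r - m) : ℝ)) * ρ ^ (-(m : ℤ))

theorem kernelIncrement_zero (F : ℕ → ℝ) (ρ : ℝ) : kernelIncrement F ρ 0 = F 0 := by
  simp [kernelIncrement]

theorem kernelIncrement_succ (F : ℕ → ℝ) {ρ : ℝ} (hρ : ρ ≠ 0) (r : ℕ) :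
    kernelIncrement F ρ (r + 1) = F (r + 1) + (r + 1) * (kernelIncrement F ρ r / ρ) := by
  have h0 : ((r + 1).factorial : ℝ) ≠ 0 := by positivity
  rw [kernelIncrement, Finset.sum_range_succ', kernelIncrement, Finset.sum_div, Finset.mul_sum,
    add_comm]
  congr 1
  · simp [h0]
  · refine Finset.sum_congr rfl fun m _ => ?_
    rw [Nat.add_sub_add_right, Nat.factorial_succ, Nat.cast_succ, neg_add, zpow_add₀ hρ,
      zpow_neg_one]
    push_cast
    ring

/-- The double sum defining the kernel, as a sum of increments. -/
theorem sum_Icc_kernel_eq {K : ℕ} (f : (Fin K → ℤ) → ℝ) (j : Fin K) (ρ : ℝ) (q : Fin K → ℤ)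
    (k : ℕ) :
    ∑ i ∈ Finset.Icc 1 k, ∑ m ∈ Finset.range (k - i + 1),
        f (Function.update q j (k : ℤ) - Pi.single j ((i : ℤ) + (m : ℤ))) *
          ((Nat.factorial (k - i) : ℝ) / (Nat.factorial (k - i - m) : ℝ)) * ρ ^ (-(m : ℤ)) =
      ∑ r ∈ Finset.range k, kernelIncrement (fun n => f (Function.update q j (n : ℤ))) ρ r := by
  refine Finset.sum_nbij' (fun i => k - i) (fun r => k - r) ?_ ?_ ?_ ?_ ?_
  · intro i hi; simp only [Finset.mem_Icc, Finset.mem_range] at *; omega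
  · intro i hi; simp only [Finset.mem_Icc, Finset.mem_range] at *; omega
  · intro i hi; simp only [Finset.mem_Icc] at *; omega
  · intro i hi; simp only [Finset.mem_range] at *; omega
  · intro i hi
    refine Finset.sum_congr rfl fun m hm => ?_
    simp only [Finset.mem_Icc, Finset.mem_range] at hi hm
    congr 3
    ext l
    rcases eq_or_ne l j with rfl | hl
    · simp only [Pi.sub_apply, Function.update_self, Pi.single_eq_same]
      omega
    · simp [hl]


/-- Lemma 3 of the paper: the explicit kernel `h` inverts the operator
`Δ_j g(q̄) = λ·(g(q̄+e_j) − g(q̄)) − μ·q_j·(g(q̄) − g(q̄−e_j))`, i.e.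
`Δ_j ((1/μ)·h) = f`. -/
theorem kernel_inverts_delta_operator
    (K : ℕ) (hK : 1 ≤ K)
    (f : (Fin K → ℤ) → ℝ)
    (j : Fin K)
    (lam μ ρ : ℝ) (hlam : 0 < lam) (hμ : 0 < μ) (hρ : ρ = lam / μ)
    (h : (Fin K → ℤ) → ℝ)
    (hh0 : ∀ q : Fin K → ℤ, q j ≤ 0 → h q = 0)
    (hh : ∀ q : Fin K → ℤ, 0 < q j →
      h q = (1 / ρ) *
        ∑ i ∈ Finset.Icc 1 (q j).toNat,
          ∑ m ∈ Finset.range ((q j).toNat - i + 1),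
            f (q - Pi.single j ((i : ℤ) + (m : ℤ))) *
              ((Nat.factorial ((q j).toNat - i) : ℝ) /
                (Nat.factorial ((q j).toNat - i - m) : ℝ)) *
              ρ ^ (-(m : ℤ))) :
    ∀ q : Fin K → ℤ, 0 ≤ q j →
      (lam * (h (q + Pi.single j 1) - h q)
          - μ * ((q j : ℤ) : ℝ) * (h q - h (q - Pi.single j 1)) = μ * f q) ∧
      (ρ * (h (q + Pi.single j 1) - h q)
          - ((q j : ℤ) : ℝ) * (h q - h (q - Pi.single j 1)) = f q) := by
  intro q hq
  have hρ0 : ρ ≠ 0 := by rw [hρ]; positivity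
  have hlamρ : lam = μ * ρ := by rw [hρ]; field_simp
  set G := kernelIncrement (fun n => f (Function.update q j (n : ℤ))) ρ with hG
  have hsum (k : ℕ) :
      h (Function.update q j (k : ℤ)) = (1 / ρ) * ∑ r ∈ Finset.range k, G r := by
    rcases Nat.eq_zero_or_pos k with rfl | hk
    · simp [hh0]
    · rw [hh _ (by simpa using hk)]
      simp only [Function.update_self, Int.toNat_natCast]
      rw [sum_Icc_kernel_eq]
  have hstep (k : ℕ) : h (Function.update q j ((k : ℤ) + 1)) - h (Function.update q j (k : ℤ)) =
      G k / ρ := by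
    have := hsum (k + 1)
    rw [Nat.cast_succ] at this
    rw [this, hsum, Finset.sum_range_succ]
    ring
  obtain ⟨n, hn⟩ := Int.eq_ofNat_of_zero_le hq
  have hupd : Function.update q j (n : ℤ) = q := by rw [← hn, Function.update_eq_self]
  have hadd : q + Pi.single j 1 = Function.update q j ((n : ℤ) + 1) := by
    ext l
    rcases eq_or_ne l j with rfl | hl <;> simp [*]
  have key : ρ * (h (q + Pi.single j 1) - h q)
      - ((q j : ℤ) : ℝ) * (h q - h (q - Pi.single j 1)) = f q := by
    have hup : ρ * (h (q + Pi.single j 1) - h q) = G n := by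
      have := hstep n
      rw [hupd] at this
      rw [hadd, this]
      field_simp
    rw [hup, hn]
    cases n with
    | zero => simpa [hG, kernelIncrement_zero] using congrArg f hupd
    | succ k =>
      have hsub : q - Pi.single j 1 = Function.update q j (k : ℤ) := by
        ext l
        rcases eq_or_ne l j with rfl | hl <;> simp [*]
      have hdown := hstep k
      rw [← Nat.cast_succ, hupd] at hdown
      rw [hsub, hdown, hG, kernelIncrement_succ _ hρ0, hupd]
      push_cast
      ring
  refine ⟨?_, key⟩
  rw [hlamρ, ← key]
  ring
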